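/- arXiv:1803.01758 — 4 statements merged into one kernel-verified Lean document; each statement's English description precedes it below -/
import Mathlib

section
/- Let (V_k, V_k⁺, e_k)_{k∈ℕ} be real AOU spaces and φ_k : V_{k+1} → V_k unital positive linear maps. Then (V∞, V∞⁺, e) is a real AOU space: V∞⁺ is a cone with V∞⁺ ∩ (−V∞⁺) = {0}, e = (e_k)_k belongs to V∞⁺ and is an order unit for (V∞, V∞⁺), and e is Archimedean (if v ∈ V∞ and r·e + v ∈ V∞⁺ for every r > 0, then v ∈ V∞⁺). -/
/-- The order seminorm of `(V_k, V_k⁺, e_k)`: `‖x‖_k = inf {r ≥ 0 : −r•e_k ≤ x ≤ r•e_k}`. -/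
noncomputable def coordNorm {V : ℕ → Type*} [∀ k, AddCommGroup (V k)] [∀ k, Module ℝ (V k)]
    (Vp : ∀ k, Set (V k)) (e : ∀ k, V k) (k : ℕ) (x : V k) : ℝ :=
  sInf {r : ℝ | 0 ≤ r ∧ r • e k - x ∈ Vp k ∧ r • e k + x ∈ Vp k}

/-- `V∞ = {v ∈ Π_k V_k : φ_k(v_{k+1}) = v_k for all k, and sup_k ‖v_k‖_k < ∞}`. -/
def aouProjLim {V : ℕ → Type*} [∀ k, AddCommGroup (V k)] [∀ k, Module ℝ (V k)]
    (φ : ∀ k, V (k + 1) →ₗ[ℝ] V k) (Vp : ∀ k, Set (V k)) (e : ∀ k, V k) :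
    Set (∀ k, V k) :=
  {v | (∀ k, φ k (v (k + 1)) = v k) ∧ BddAbove (Set.range fun k => coordNorm Vp e k (v k))}

/-- `V∞⁺ = {v ∈ V∞ : v_k ∈ V_k⁺ for all k}`. -/
def aouProjLimPos {V : ℕ → Type*} [∀ k, AddCommGroup (V k)] [∀ k, Module ℝ (V k)]
    (φ : ∀ k, V (k + 1) →ₗ[ℝ] V k) (Vp : ∀ k, Set (V k)) (e : ∀ k, V k) :
    Set (∀ k, V k) :=
  {v | v ∈ aouProjLim φ Vp e ∧ ∀ k, v k ∈ Vp k}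

/-- `V∞` consists of the coherent sequences that are uniformly dominated by the order units. -/
theorem mem_aouProjLim_iff
    {V : ℕ → Type*} [∀ k, AddCommGroup (V k)] [∀ k, Module ℝ (V k)]
    {Vp : ∀ k, Set (V k)} {e : ∀ k, V k}
    (hadd : ∀ k, ∀ x ∈ Vp k, ∀ y ∈ Vp k, x + y ∈ Vp k)
    (hsmul : ∀ k, ∀ r : ℝ, 0 ≤ r → ∀ x ∈ Vp k, r • x ∈ Vp k)
    (he : ∀ k, e k ∈ Vp k)
    (hunit : ∀ k, ∀ x : V k, ∃ r : ℝ, 0 < r ∧ r • e k - x ∈ Vp k ∧ r • e k + x ∈ Vp k)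
    {φ : ∀ k, V (k + 1) →ₗ[ℝ] V k} {v : ∀ k, V k} :
    v ∈ aouProjLim φ Vp e ↔ (∀ k, φ k (v (k + 1)) = v k) ∧
      ∃ r : ℝ, 0 < r ∧ ∀ k, r • e k - v k ∈ Vp k ∧ r • e k + v k ∈ Vp k := by
  refine and_congr_right fun _ => ⟨?_, ?_⟩
  · rintro ⟨C, hC⟩
    refine ⟨max C 0 + 1, by positivity, fun k => ?_⟩
    have hlt : coordNorm Vp e k (v k) < max C 0 + 1 :=
      (hC ⟨k, rfl⟩).trans_lt (by linarith [le_max_left C 0])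
    obtain ⟨r, hr, hr'⟩ := hunit k (v k)
    obtain ⟨s, ⟨-, hsub, hsum⟩, hs⟩ := exists_lt_of_csInf_lt (by exact ⟨r, hr.le, hr'⟩) hlt
    have hdiff := hsmul k (max C 0 + 1 - s) (by linarith) _ (he k)
    constructor
    · convert hadd k _ hdiff _ hsub using 1
      module
    · convert hadd k _ hdiff _ hsum using 1
      module
  · rintro ⟨r, hr, h⟩
    refine ⟨r, ?_⟩
    rintro _ ⟨k, rfl⟩
    exact csInf_le ⟨0, fun _ hs => hs.1⟩ ⟨hr.le, h k⟩

/-- `(V∞, V∞⁺, e)` is a real AOU space: `V∞⁺` is a proper cone, and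
`e = (e_k)_k ∈ V∞⁺` is an Archimedean order unit for `(V∞, V∞⁺)`. -/
theorem stmt5
    {V : ℕ → Type*} [∀ k, AddCommGroup (V k)] [∀ k, Module ℝ (V k)]
    (Vp : ∀ k, Set (V k)) (e : ∀ k, V k)
    -- each (V_k, V_k⁺, e_k) is a real AOU space
    (hadd : ∀ k, ∀ x ∈ Vp k, ∀ y ∈ Vp k, x + y ∈ Vp k)
    (hsmul : ∀ k, ∀ r : ℝ, 0 ≤ r → ∀ x ∈ Vp k, r • x ∈ Vp k)
    (hproper : ∀ k, ∀ x, x ∈ Vp k → -x ∈ Vp k → x = 0)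
    (he : ∀ k, e k ∈ Vp k)
    (hunit : ∀ k, ∀ x : V k, ∃ r : ℝ, 0 < r ∧ r • e k - x ∈ Vp k ∧ r • e k + x ∈ Vp k)
    (harch : ∀ k, ∀ x : V k, (∀ r : ℝ, 0 < r → r • e k + x ∈ Vp k) → x ∈ Vp k)
    -- the connecting maps are unital and positive
    (φ : ∀ k, V (k + 1) →ₗ[ℝ] V k)
    (hφunital : ∀ k, φ k (e (k + 1)) = e k)
    (hφpos : ∀ k, ∀ x ∈ Vp (k + 1), φ k x ∈ Vp k) :
    -- V∞⁺ is a cone ...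
    (∀ x ∈ aouProjLimPos φ Vp e, ∀ y ∈ aouProjLimPos φ Vp e, x + y ∈ aouProjLimPos φ Vp e) ∧
    (∀ r : ℝ, 0 ≤ r → ∀ x ∈ aouProjLimPos φ Vp e, r • x ∈ aouProjLimPos φ Vp e) ∧
    -- ... with V∞⁺ ∩ (−V∞⁺) = {0},
    (∀ x, x ∈ aouProjLimPos φ Vp e → -x ∈ aouProjLimPos φ Vp e → x = 0) ∧
    -- e ∈ V∞⁺,
    e ∈ aouProjLimPos φ Vp e ∧
    -- e is an order unit for (V∞, V∞⁺),
    (∀ v ∈ aouProjLim φ Vp e, ∃ r : ℝ, 0 < r ∧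
      r • e - v ∈ aouProjLimPos φ Vp e ∧ r • e + v ∈ aouProjLimPos φ Vp e) ∧
    -- and e is Archimedean
    (∀ v ∈ aouProjLim φ Vp e,
      (∀ r : ℝ, 0 < r → r • e + v ∈ aouProjLimPos φ Vp e) → v ∈ aouProjLimPos φ Vp e) := by
  have mem_iff := fun v => mem_aouProjLim_iff hadd hsmul he hunit (φ := φ) (v := v)
  have add_mem : ∀ x ∈ aouProjLim φ Vp e, ∀ y ∈ aouProjLim φ Vp e,
      x + y ∈ aouProjLim φ Vp e := by
    intro x hx y hy
    obtain ⟨hxφ, r, hr, hxr⟩ := (mem_iff x).1 hx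
    obtain ⟨hyφ, s, hs, hys⟩ := (mem_iff y).1 hy
    refine (mem_iff _).2 ⟨fun k => by simp [hxφ, hyφ], r + s, by positivity, fun k => ⟨?_, ?_⟩⟩
    · convert hadd k _ (hxr k).1 _ (hys k).1 using 1
      simp only [Pi.add_apply]
      module
    · convert hadd k _ (hxr k).2 _ (hys k).2 using 1
      simp only [Pi.add_apply]
      module
  have neg_mem : ∀ x ∈ aouProjLim φ Vp e, -x ∈ aouProjLim φ Vp e := by
    intro x hx
    obtain ⟨hxφ, r, hr, hxr⟩ := (mem_iff x).1 hx
    refine (mem_iff _).2 ⟨fun k => by simp [hxφ], r, hr, fun k => ⟨?_, ?_⟩⟩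
    · simpa using (hxr k).2
    · simpa [sub_eq_add_neg] using (hxr k).1
  have smul_mem : ∀ r : ℝ, 0 ≤ r → ∀ x ∈ aouProjLim φ Vp e, r • x ∈ aouProjLim φ Vp e := by
    intro r hr x hx
    obtain ⟨hxφ, s, hs, hxs⟩ := (mem_iff x).1 hx
    refine (mem_iff _).2 ⟨fun k => by simp [hxφ], r * s + 1, by positivity, fun k => ⟨?_, ?_⟩⟩
    · convert hadd k _ (hsmul k r hr _ (hxs k).1) _ (he k) using 1
      simp only [Pi.smul_apply]
      module
    · convert hadd k _ (hsmul k r hr _ (hxs k).2) _ (he k) using 1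
      simp only [Pi.smul_apply]
      module
  have e_mem : e ∈ aouProjLim φ Vp e := by
    refine (mem_iff _).2 ⟨hφunital, 1, one_pos, fun k => ⟨?_, ?_⟩⟩
    · simpa using hsmul k 0 le_rfl _ (he k)
    · simpa using hadd k _ (he k) _ (he k)
  refine ⟨fun x hx y hy => ⟨add_mem x hx.1 y hy.1, fun k => hadd k _ (hx.2 k) _ (hy.2 k)⟩,
    fun r hr x hx => ⟨smul_mem r hr x hx.1, fun k => hsmul k r hr _ (hx.2 k)⟩,
    fun x hx hx' => funext fun k => hproper k _ (hx.2 k) (hx'.2 k),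
    ⟨e_mem, he⟩, fun v hv => ?_,
    fun v hv h => ⟨hv, fun k => harch k _ fun r hr => (h r hr).2 k⟩⟩
  obtain ⟨-, r, hr, hvr⟩ := (mem_iff v).1 hv
  have hre := smul_mem r hr.le e e_mem
  refine ⟨r, hr, ⟨?_, fun k => (hvr k).1⟩, add_mem _ hre _ hv, fun k => (hvr k).2⟩
  rw [sub_eq_add_neg]
  exact add_mem _ hre _ (neg_mem v hv)
end

section
/- Let (V_k, V_k⁺, e_k)_{k∈ℕ} be real AOU spaces and φ_k : V_{k+1} → V_k unital positive linear maps. Then for every v ∈ V∞, the order seminorm of v in V∞ determined by e equals the supremum of the coordinate order seminorms: inf{r ≥ 0 : −r·e ≤ v ≤ r·e in (V∞, V∞⁺)} = sup_k inf{r ≥ 0 : −r·e_k ≤ v_k ≤ r·e_k in (V_k, V_k⁺)}. -/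
theorem coordNorm_le_of_mem {V : ℕ → Type*} [∀ k, AddCommGroup (V k)] [∀ k, Module ℝ (V k)]
    {Vp : ∀ k, Set (V k)} {e : ∀ k, V k} {k : ℕ} {x : V k} {r : ℝ} (hr : 0 ≤ r)
    (hsub : r • e k - x ∈ Vp k) (hadd : r • e k + x ∈ Vp k) : coordNorm Vp e k x ≤ r :=
  csInf_le ⟨0, fun _ h => h.1⟩ ⟨hr, hsub, hadd⟩

theorem coordNorm_nonneg {V : ℕ → Type*} [∀ k, AddCommGroup (V k)] [∀ k, Module ℝ (V k)]
    (Vp : ∀ k, Set (V k)) (e : ∀ k, V k) (k : ℕ) (x : V k) : 0 ≤ coordNorm Vp e k x :=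
  Real.sInf_nonneg fun _ h => h.1

/-- The infimum defining the order seminorm is attained, by the Archimedean property. -/
theorem mem_of_coordNorm_le {V : ℕ → Type*} [∀ k, AddCommGroup (V k)] [∀ k, Module ℝ (V k)]
    {Vp : ∀ k, Set (V k)} {e : ∀ k, V k} {k : ℕ}
    (hadd : ∀ x ∈ Vp k, ∀ y ∈ Vp k, x + y ∈ Vp k)
    (hsmul : ∀ r : ℝ, 0 ≤ r → ∀ x ∈ Vp k, r • x ∈ Vp k)
    (he : e k ∈ Vp k)
    (hunit : ∀ x : V k, ∃ r : ℝ, 0 < r ∧ r • e k - x ∈ Vp k ∧ r • e k + x ∈ Vp k)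
    (harch : ∀ x : V k, (∀ r : ℝ, 0 < r → r • e k + x ∈ Vp k) → x ∈ Vp k)
    {x : V k} {s : ℝ} (hs : coordNorm Vp e k x ≤ s) :
    s • e k - x ∈ Vp k ∧ s • e k + x ∈ Vp k := by
  have key : ∀ ε : ℝ, 0 < ε →
      ε • e k + (s • e k - x) ∈ Vp k ∧ ε • e k + (s • e k + x) ∈ Vp k := by
    intro ε hε
    obtain ⟨r, hr, hr'⟩ := hunit x
    obtain ⟨t, ⟨-, hsub, hplus⟩, hts⟩ :=
      exists_lt_of_csInf_lt (s := {r : ℝ | 0 ≤ r ∧ r • e k - x ∈ Vp k ∧ r • e k + x ∈ Vp k})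
        ⟨r, hr.le, hr'⟩ (lt_of_le_of_lt hs (lt_add_of_pos_right s hε))
    have hpos := hsmul (s + ε - t) (by linarith) _ he
    constructor
    · convert hadd _ hpos _ hsub using 1
      module
    · convert hadd _ hpos _ hplus using 1
      module
  exact ⟨harch _ fun ε hε => (key ε hε).1, harch _ fun ε hε => (key ε hε).2⟩

/-- For every `v ∈ V∞`, the order seminorm of `v` in `(V∞, V∞⁺, e)` equals
the supremum of the coordinate order seminorms. -/
theorem stmt6
    {V : ℕ → Type*} [∀ k, AddCommGroup (V k)] [∀ k, Module ℝ (V k)]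
    (Vp : ∀ k, Set (V k)) (e : ∀ k, V k)
    (hadd : ∀ k, ∀ x ∈ Vp k, ∀ y ∈ Vp k, x + y ∈ Vp k)
    (hsmul : ∀ k, ∀ r : ℝ, 0 ≤ r → ∀ x ∈ Vp k, r • x ∈ Vp k)
    (hproper : ∀ k, ∀ x, x ∈ Vp k → -x ∈ Vp k → x = 0)
    (he : ∀ k, e k ∈ Vp k)
    (hunit : ∀ k, ∀ x : V k, ∃ r : ℝ, 0 < r ∧ r • e k - x ∈ Vp k ∧ r • e k + x ∈ Vp k)
    (harch : ∀ k, ∀ x : V k, (∀ r : ℝ, 0 < r → r • e k + x ∈ Vp k) → x ∈ Vp k)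
    (φ : ∀ k, V (k + 1) →ₗ[ℝ] V k)
    (hφunital : ∀ k, φ k (e (k + 1)) = e k)
    (hφpos : ∀ k, ∀ x ∈ Vp (k + 1), φ k x ∈ Vp k) :
    ∀ v ∈ aouProjLim φ Vp e,
      sInf {r : ℝ | 0 ≤ r ∧
          r • e - v ∈ aouProjLimPos φ Vp e ∧ r • e + v ∈ aouProjLimPos φ Vp e} =
        ⨆ k, coordNorm Vp e k (v k) := by
  intro v hv
  obtain ⟨hcompat, hbdd⟩ := hv
  set S := ⨆ k, coordNorm Vp e k (v k) with hS
  have hS0 : 0 ≤ S := Real.iSup_nonneg fun k => coordNorm_nonneg Vp e k (v k)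
  have hmem : ∀ k, S • e k - v k ∈ Vp k ∧ S • e k + v k ∈ Vp k := fun k =>
    mem_of_coordNorm_le (hadd k) (hsmul k) (he k) (hunit k) (harch k) (le_ciSup hbdd k)
  have htwo : ∀ k, (2 * S) • e k ∈ Vp k := fun k => hsmul k _ (by positivity) _ (he k)
  refine IsLeast.csInf_eq ⟨⟨hS0, ⟨⟨fun k => ?_, 2 * S, ?_⟩, fun k => (hmem k).1⟩,
    ⟨⟨fun k => ?_, 2 * S, ?_⟩, fun k => (hmem k).2⟩⟩, ?_⟩
  · simp [hφunital, hcompat]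
  · rintro _ ⟨k, rfl⟩
    refine coordNorm_le_of_mem (by positivity) ?_ ?_
    · convert (hmem k).2 using 1
      simp only [Pi.sub_apply, Pi.smul_apply]
      module
    · exact hadd k _ (htwo k) _ (hmem k).1
  · simp [hφunital, hcompat]
  · rintro _ ⟨k, rfl⟩
    refine coordNorm_le_of_mem (by positivity) ?_ ?_
    · convert (hmem k).1 using 1
      simp only [Pi.add_apply, Pi.smul_apply]
      module
    · exact hadd k _ (htwo k) _ (hmem k).2
  · rintro r ⟨hr, hsub, hplus⟩
    exact ciSup_le fun k => coordNorm_le_of_mem hr (hsub.2 k) (hplus.2 k)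
end

section
/- Let (V_k, V_k⁺, e_k)_{k∈ℕ} be real AOU spaces and φ_k : V_{k+1} → V_k unital positive linear maps. Then (V∞, {p_k}) is the projective limit of (V_k, φ_k) in the category of real AOU spaces with unital positive linear maps: each p_k is unital and positive with φ_k ∘ p_{k+1} = p_k, and for every real AOU space (W, W⁺, e_W) and every family of unital positive linear maps q_k : W → V_k satisfying φ_k ∘ q_{k+1} = q_k for all k, there exists a unique unital positive linear map ψ : W → V∞ such that p_k ∘ ψ = q_k for every k. -/
/-- If `-r•e_k ≤ v_k ≤ r•e_k` for all `k`, then the order seminorms of the coordinates of `v` are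
bounded. -/
theorem bddAbove_range_coordNorm {V : ℕ → Type*} [∀ k, AddCommGroup (V k)]
    [∀ k, Module ℝ (V k)] {Vp : ∀ k, Set (V k)} {e v : ∀ k, V k} {r : ℝ} (hr : 0 ≤ r)
    (hsub : ∀ k, r • e k - v k ∈ Vp k) (hadd : ∀ k, r • e k + v k ∈ Vp k) :
    BddAbove (Set.range fun k => coordNorm Vp e k (v k)) := by
  refine ⟨r, ?_⟩
  rintro _ ⟨k, rfl⟩
  exact csInf_le ⟨0, fun _ hs => hs.1⟩ ⟨hr, hsub k, hadd k⟩

/-- `(V∞, {p_k})` is the projective limit of `(V_k, φ_k)` in the category of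
real AOU spaces with unital positive linear maps: the coordinate maps `p_k` are unital,
positive and compatible, and the universal property holds.  (Morphisms into `V∞` are
represented by linear maps into the product whose range lies in `V∞`, with `p_k` the
coordinate evaluations.) -/
theorem stmt7
    {V : ℕ → Type*} [∀ k, AddCommGroup (V k)] [∀ k, Module ℝ (V k)]
    (Vp : ∀ k, Set (V k)) (e : ∀ k, V k)
    (hadd : ∀ k, ∀ x ∈ Vp k, ∀ y ∈ Vp k, x + y ∈ Vp k)
    (hsmul : ∀ k, ∀ r : ℝ, 0 ≤ r → ∀ x ∈ Vp k, r • x ∈ Vp k)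
    (hproper : ∀ k, ∀ x, x ∈ Vp k → -x ∈ Vp k → x = 0)
    (he : ∀ k, e k ∈ Vp k)
    (hunit : ∀ k, ∀ x : V k, ∃ r : ℝ, 0 < r ∧ r • e k - x ∈ Vp k ∧ r • e k + x ∈ Vp k)
    (harch : ∀ k, ∀ x : V k, (∀ r : ℝ, 0 < r → r • e k + x ∈ Vp k) → x ∈ Vp k)
    (φ : ∀ k, V (k + 1) →ₗ[ℝ] V k)
    (hφunital : ∀ k, φ k (e (k + 1)) = e k)
    (hφpos : ∀ k, ∀ x ∈ Vp (k + 1), φ k x ∈ Vp k) :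
    -- each p_k is unital and positive, and φ_k ∘ p_{k+1} = p_k on V∞:
    (e ∈ aouProjLim φ Vp e ∧
      (∀ v ∈ aouProjLimPos φ Vp e, ∀ k, v k ∈ Vp k) ∧
      (∀ v ∈ aouProjLim φ Vp e, ∀ k, φ k (v (k + 1)) = v k)) ∧
    -- universal property:
    (∀ (W : Type*) [AddCommGroup W] [Module ℝ W], ∀ (Wp : Set W) (eW : W),
      (∀ x ∈ Wp, ∀ y ∈ Wp, x + y ∈ Wp) →
      (∀ r : ℝ, 0 ≤ r → ∀ x ∈ Wp, r • x ∈ Wp) →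
      (∀ x, x ∈ Wp → -x ∈ Wp → x = 0) →
      eW ∈ Wp →
      (∀ w : W, ∃ r : ℝ, 0 < r ∧ r • eW - w ∈ Wp ∧ r • eW + w ∈ Wp) →
      (∀ w : W, (∀ r : ℝ, 0 < r → r • eW + w ∈ Wp) → w ∈ Wp) →
      ∀ q : ∀ k, W →ₗ[ℝ] V k,
        (∀ k, q k eW = e k) →
        (∀ k, ∀ w ∈ Wp, q k w ∈ Vp k) →
        (∀ k w, φ k (q (k + 1) w) = q k w) →
        ∃! ψ : W →ₗ[ℝ] (∀ k, V k),
          (∀ w, ψ w ∈ aouProjLim φ Vp e) ∧ ψ eW = e ∧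
          (∀ w ∈ Wp, ψ w ∈ aouProjLimPos φ Vp e) ∧
          (∀ k w, ψ w k = q k w)) := by
  refine ⟨⟨⟨hφunital, ?_⟩, fun v hv => hv.2, fun v hv => hv.1⟩, ?_⟩
  · refine bddAbove_range_coordNorm zero_le_one (fun k => ?_) fun k => ?_
    · rw [one_smul, sub_self]
      simpa using hsmul k 0 le_rfl _ (he k)
    · rw [one_smul]
      exact hadd k _ (he k) _ (he k)
  · intro W _ _ Wp eW _ _ _ _ hWunit _ q hqunital hqpos hqcomp
    have hmem : ∀ w, LinearMap.pi q w ∈ aouProjLim φ Vp e := by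
      intro w
      obtain ⟨r, hr, hsub, hsum⟩ := hWunit w
      refine ⟨fun k => hqcomp k w, bddAbove_range_coordNorm hr.le (fun k => ?_) fun k => ?_⟩
      · simpa [hqunital] using hqpos k _ hsub
      · simpa [hqunital] using hqpos k _ hsum
    refine ⟨LinearMap.pi q, ⟨hmem, funext hqunital, fun w hw => ⟨hmem w, fun k => hqpos k w hw⟩,
      fun _ _ => rfl⟩, ?_⟩
    rintro ψ ⟨_, _, _, hψ⟩
    ext w k
    exact hψ k w
end

section
/- Let S ⊆ B(H) be a concrete operator system and T ⊆ S a norm-dense operator subsystem. Then every continuous linear functional g on T has a unique continuous linear extension g̃ on S, and the map g ↦ g̃ is a linear order isomorphism from the ordered dual T' onto the ordered dual S' (g is positive on T⁺ if and only if g̃ is positive on S⁺). Moreover, if δ is a positive continuous functional on T which is an order unit for T' (for every hermitian g ∈ T' there is r > 0 with r·δ − g positive), then its extension δ̃ is an Archimedean order unit for S'. -/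
/-- A continuous linear functional on an operator (sub)system `S ⊆ B(H)` is positive if it
maps `S⁺ = S ∩ B(H)⁺` into `[0, ∞)`. -/
def PosFun {H : Type*} [NormedAddCommGroup H] [InnerProductSpace ℂ H] [CompleteSpace H]
    (S : Submodule ℂ (H →L[ℂ] H)) (f : S →L[ℂ] ℂ) : Prop :=
  ∀ T : S, ContinuousLinearMap.IsPositive (T : H →L[ℂ] H) → ∃ r : ℝ, 0 ≤ r ∧ f T = (r : ℂ)

/-- A continuous linear functional on a selfadjoint subspace `S ⊆ B(H)` is hermitian if
`f(X*) = conj (f X)` for all `X ∈ S`. -/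
def HermFun {H : Type*} [NormedAddCommGroup H] [InnerProductSpace ℂ H] [CompleteSpace H]
    (S : Submodule ℂ (H →L[ℂ] H)) (hstar : ∀ X ∈ S, star X ∈ S) (f : S →L[ℂ] ℂ) : Prop :=
  ∀ X : S, f ⟨star (X : H →L[ℂ] H), hstar _ X.2⟩ = starRingEnd ℂ (f X)

/-- A positive functional `δ` is an order unit for the ordered dual `S'`. -/
def OrderUnitFun {H : Type*} [NormedAddCommGroup H] [InnerProductSpace ℂ H] [CompleteSpace H]
    (S : Submodule ℂ (H →L[ℂ] H)) (hstar : ∀ X ∈ S, star X ∈ S) (δ : S →L[ℂ] ℂ) : Prop :=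
  ∀ f : S →L[ℂ] ℂ, HermFun S hstar f → ∃ r : ℝ, 0 < r ∧ PosFun S ((r : ℂ) • δ - f)

/-- The Archimedean property for `δ` in the ordered dual `S'`. -/
def ArchFun {H : Type*} [NormedAddCommGroup H] [InnerProductSpace ℂ H] [CompleteSpace H]
    (S : Submodule ℂ (H →L[ℂ] H)) (hstar : ∀ X ∈ S, star X ∈ S) (δ : S →L[ℂ] ℂ) : Prop :=
  ∀ f : S →L[ℂ] ℂ, HermFun S hstar f →
    (∀ r : ℝ, 0 < r → PosFun S ((r : ℂ) • δ + f)) → PosFun S f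

/-- `ExtFun hTS g f` says that the continuous functional `f` on `S` extends the continuous
functional `g` on the subspace `T ≤ S`. -/
def ExtFun {H : Type*} [NormedAddCommGroup H] [InnerProductSpace ℂ H] [CompleteSpace H]
    {T S : Submodule ℂ (H →L[ℂ] H)} (hTS : T ≤ S)
    (g : T →L[ℂ] ℂ) (f : S →L[ℂ] ℂ) : Prop :=
  ∀ x : H →L[ℂ] H, ∀ hx : x ∈ T, f ⟨x, hTS hx⟩ = g ⟨x, hx⟩

theorem posFun_iff_nonneg {H : Type*} [NormedAddCommGroup H] [InnerProductSpace ℂ H]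
    [CompleteSpace H] {S : Submodule ℂ (H →L[ℂ] H)} {f : S →L[ℂ] ℂ} :
    PosFun S f ↔ ∀ x : S, 0 ≤ (x : H →L[ℂ] H) → 0 ≤ (f x).re ∧ (f x).im = 0 := by
  refine forall_congr' fun x => ?_
  rw [ContinuousLinearMap.nonneg_iff_isPositive]
  refine imp_congr_right fun _ => ⟨?_, fun h => ⟨(f x).re, h.1, Complex.ext rfl (by simp [h.2])⟩⟩
  rintro ⟨r, hr, h⟩
  simp [h, hr]

theorem isClosed_setOf_re_nonneg_and_im_eq_zero : IsClosed {z : ℂ | 0 ≤ z.re ∧ z.im = 0} :=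
  (isClosed_le continuous_const Complex.continuous_re).inter
    (isClosed_eq Complex.continuous_im continuous_const)

/-- The hermitian part `(t + t*) / 2` of `t`, shifted by its distance to `x`. If `x` is positive,
this is a positive operator, and it equals `x` for `t = x`. -/
noncomputable def shiftedHermitianPart {A : Type*} [CStarAlgebra A] (x t : A) : A :=
  (2⁻¹ : ℂ) • (t + star t) + (‖(2⁻¹ : ℂ) • (t + star t) - x‖ : ℂ) • (1 : A)

section shiftedHermitianPart

variable {A : Type*} [CStarAlgebra A]

theorem continuous_shiftedHermitianPart (x : A) : Continuous (shiftedHermitianPart x) := by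
  unfold shiftedHermitianPart
  fun_prop

theorem shiftedHermitianPart_self {x : A} (hx : IsSelfAdjoint x) :
    shiftedHermitianPart x x = x := by
  have h : (2⁻¹ : ℂ) • (x + star x) = x := by
    rw [hx.star_eq, ← two_smul ℂ x, smul_smul]
    norm_num
  simp [shiftedHermitianPart, h]

theorem shiftedHermitianPart_nonneg [PartialOrder A] [StarOrderedRing A] {x : A} (hx : 0 ≤ x)
    (t : A) : 0 ≤ shiftedHermitianPart x t := by
  have ht : IsSelfAdjoint ((2⁻¹ : ℂ) • (t + star t)) := by
    simp [isSelfAdjoint_iff, add_comm]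
  have h := (ht.sub (IsSelfAdjoint.of_nonneg hx)).neg_algebraMap_norm_le_self
  rw [Algebra.algebraMap_eq_smul_one, neg_le_iff_add_nonneg] at h
  have h' := add_nonneg h hx
  rw [shiftedHermitianPart, Complex.coe_smul]
  convert h' using 1
  abel

theorem shiftedHermitianPart_mem {S : Submodule ℂ A} (hone : (1 : A) ∈ S)
    (hstar : ∀ X ∈ S, star X ∈ S) (x : A) {t : A} (ht : t ∈ S) :
    shiftedHermitianPart x t ∈ S :=
  S.add_mem (S.smul_mem _ (S.add_mem ht (hstar t ht))) (S.smul_mem _ hone)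

end shiftedHermitianPart

theorem denseRange_inclusion_of_subset_closure {E : Type*} [NormedAddCommGroup E]
    [NormedSpace ℂ E] {S T : Submodule ℂ E} (hTS : T ≤ S)
    (hdense : (S : Set E) ⊆ closure (T : Set E)) :
    DenseRange (Submodule.inclusion hTS) :=
  (denseRange_inclusion_iff (s := (T : Set E)) (t := (S : Set E)) hTS).2 hdense

theorem exists_extension_of_subset_closure {E : Type*} [NormedAddCommGroup E]
    [NormedSpace ℂ E] {S T : Submodule ℂ E} (hTS : T ≤ S)
    (hdense : (S : Set E) ⊆ closure (T : Set E)) (g : T →L[ℂ] ℂ) :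
    ∃ f : S →L[ℂ] ℂ, ∀ x : T, f (Submodule.inclusion hTS x) = g x := by
  let ι : T →L[ℂ] S := ⟨Submodule.inclusion hTS, continuous_inclusion hTS⟩
  have hι : IsUniformInducing ι :=
    (AddMonoidHomClass.isometry_of_norm ι fun _ => rfl).isUniformInducing
  exact ⟨g.extend ι, ContinuousLinearMap.extend_eq g
    (denseRange_inclusion_of_subset_closure hTS hdense) hι⟩

section Extension

variable {H : Type*} [NormedAddCommGroup H] [InnerProductSpace ℂ H] [CompleteSpace H]
  {S T : Submodule ℂ (H →L[ℂ] H)} {hTS : T ≤ S}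

theorem ExtFun.posFun_iff (honeT : (1 : H →L[ℂ] H) ∈ T)
    (hstarS : ∀ X ∈ S, star X ∈ S) (hstarT : ∀ X ∈ T, star X ∈ T)
    (hdense : (S : Set (H →L[ℂ] H)) ⊆ closure (T : Set (H →L[ℂ] H)))
    {g : T →L[ℂ] ℂ} {f : S →L[ℂ] ℂ} (hgf : ExtFun hTS g f) : PosFun T g ↔ PosFun S f := by
  rw [posFun_iff_nonneg, posFun_iff_nonneg]
  constructor
  · intro hg x hx
    have hmem (t : S) : shiftedHermitianPart (x : H →L[ℂ] H) t ∈ S :=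
      shiftedHermitianPart_mem (hTS honeT) hstarS _ t.2
    let φ (t : S) : S := ⟨shiftedHermitianPart (x : H →L[ℂ] H) t, hmem t⟩
    have hφ : Continuous φ :=
      ((continuous_shiftedHermitianPart _).comp continuous_subtype_val).subtype_mk _
    have hφx : φ x = x := Subtype.ext (shiftedHermitianPart_self (IsSelfAdjoint.of_nonneg hx))
    rw [← hφx]
    refine (denseRange_inclusion_of_subset_closure hTS hdense).induction_on
      (p := fun s => 0 ≤ (f (φ s)).re ∧ (f (φ s)).im = 0) x ?_ fun t => ?_
    · exact isClosed_setOf_re_nonneg_and_im_eq_zero.preimage (f.continuous.comp hφ)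
    · have ht := shiftedHermitianPart_mem honeT hstarT (x : H →L[ℂ] H) t.2
      have h := hg ⟨_, ht⟩ (shiftedHermitianPart_nonneg hx _)
      rwa [← hgf _ ht] at h
  · intro hf x hx
    rw [← hgf x x.2]
    exact hf _ hx

theorem ExtFun.eq_of_dense (hdense : (S : Set (H →L[ℂ] H)) ⊆ closure (T : Set (H →L[ℂ] H)))
    {g : T →L[ℂ] ℂ} {f₁ f₂ : S →L[ℂ] ℂ} (h₁ : ExtFun hTS g f₁) (h₂ : ExtFun hTS g f₂) :
    f₁ = f₂ :=
  DFunLike.coe_injective <|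
    (denseRange_inclusion_of_subset_closure hTS hdense).equalizer f₁.continuous f₂.continuous <|
      funext fun t => (h₁ t t.2).trans (h₂ t t.2).symm

theorem exists_extFun (hdense : (S : Set (H →L[ℂ] H)) ⊆ closure (T : Set (H →L[ℂ] H)))
    (g : T →L[ℂ] ℂ) : ∃ f : S →L[ℂ] ℂ, ExtFun hTS g f := by
  obtain ⟨f, hf⟩ := exists_extension_of_subset_closure hTS hdense g
  exact ⟨f, fun x hx => hf ⟨x, hx⟩⟩

theorem extFun_restrict (f : S →L[ℂ] ℂ) :
    ExtFun hTS (f.comp ⟨Submodule.inclusion hTS, continuous_inclusion hTS⟩) f :=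
  fun _ _ => rfl

theorem ExtFun.smul_add {g₁ g₂ : T →L[ℂ] ℂ} {f₁ f₂ : S →L[ℂ] ℂ} (h₁ : ExtFun hTS g₁ f₁)
    (h₂ : ExtFun hTS g₂ f₂) (c : ℂ) : ExtFun hTS (c • g₁ + g₂) (c • f₁ + f₂) := fun x hx => by
  simp [h₁ x hx, h₂ x hx]

theorem archFun (hstar : ∀ X ∈ S, star X ∈ S) (δ : S →L[ℂ] ℂ) : ArchFun S hstar δ := by
  intro f _ hf
  simp only [posFun_iff_nonneg] at hf ⊢
  intro x hx
  have hlim : Filter.Tendsto (fun r : ℝ => ((r : ℂ) • δ + f) x) (nhdsWithin 0 (Set.Ioi 0))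
      (nhds (f x)) := by
    have hc : Continuous fun r : ℝ => (r : ℂ) * δ x + f x := by fun_prop
    simpa using (hc.tendsto 0).mono_left nhdsWithin_le_nhds
  have hev : ∀ᶠ r : ℝ in nhdsWithin 0 (Set.Ioi 0),
      ((r : ℂ) • δ + f) x ∈ {z : ℂ | 0 ≤ z.re ∧ z.im = 0} :=
    eventually_mem_nhdsWithin.mono fun r hr => hf r hr x hx
  exact isClosed_setOf_re_nonneg_and_im_eq_zero.mem_of_tendsto hlim hev

theorem ExtFun.orderUnitFun (honeT : (1 : H →L[ℂ] H) ∈ T)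
    (hstarS : ∀ X ∈ S, star X ∈ S) (hstarT : ∀ X ∈ T, star X ∈ T)
    (hdense : (S : Set (H →L[ℂ] H)) ⊆ closure (T : Set (H →L[ℂ] H)))
    {δ : T →L[ℂ] ℂ} {δ' : S →L[ℂ] ℂ} (hδ : ExtFun hTS δ δ')
    (hunit : OrderUnitFun T hstarT δ) : OrderUnitFun S hstarS δ' := by
  intro f hf
  have hgf := extFun_restrict (hTS := hTS) f
  obtain ⟨r, hr, hpos⟩ := hunit (f.comp ⟨Submodule.inclusion hTS, continuous_inclusion hTS⟩)
    fun X => hf ⟨X, hTS X.2⟩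
  refine ⟨r, hr, (ExtFun.posFun_iff (hTS := hTS) honeT hstarS hstarT hdense ?_).1 hpos⟩
  intro x hx
  simp [hδ x hx, ← hgf x hx]

end Extension

/-- For a norm-dense operator subsystem `T` of a concrete operator system
`S`, every continuous functional on `T` has a unique continuous extension to `S`; the
extension map is a linear bijection from `T'` onto `S'` and an order isomorphism; and if a
positive `δ ∈ T'` is an order unit for `T'`, then its extension is an Archimedean order
unit for `S'`. -/
theorem stmt15
    {H : Type*} [NormedAddCommGroup H] [InnerProductSpace ℂ H] [CompleteSpace H]
    (S T : Submodule ℂ (H →L[ℂ] H)) (hTS : T ≤ S)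
    (honeS : (1 : H →L[ℂ] H) ∈ S) (hstarS : ∀ X ∈ S, star X ∈ S)
    (honeT : (1 : H →L[ℂ] H) ∈ T) (hstarT : ∀ X ∈ T, star X ∈ T)
    (hdense : (S : Set (H →L[ℂ] H)) ⊆ closure (T : Set (H →L[ℂ] H))) :
    -- every g ∈ T' has a unique continuous extension to S
    (∀ g : T →L[ℂ] ℂ, ∃! f : S →L[ℂ] ℂ, ExtFun hTS g f) ∧
    -- the extension map is a bijection from T' onto S'
    (∀ f : S →L[ℂ] ℂ, ∃! g : T →L[ℂ] ℂ, ExtFun hTS g f) ∧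
    -- it is linear
    (∀ (c : ℂ) (g₁ g₂ : T →L[ℂ] ℂ) (f₁ f₂ : S →L[ℂ] ℂ), ExtFun hTS g₁ f₁ →
      ExtFun hTS g₂ f₂ → ExtFun hTS (c • g₁ + g₂) (c • f₁ + f₂)) ∧
    -- it is an order isomorphism
    (∀ (g : T →L[ℂ] ℂ) (f : S →L[ℂ] ℂ), ExtFun hTS g f → (PosFun T g ↔ PosFun S f)) ∧
    -- order units of T' extend to Archimedean order units of S'
    (∀ (δ : T →L[ℂ] ℂ) (δ' : S →L[ℂ] ℂ), ExtFun hTS δ δ' → PosFun T δ →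
      OrderUnitFun T hstarT δ →
        OrderUnitFun S hstarS δ' ∧ ArchFun S hstarS δ') := by
  refine ⟨fun g => ?_, fun f => ?_, fun c _ _ _ _ h₁ h₂ => h₁.smul_add h₂ c,
    fun _ _ h => h.posFun_iff honeT hstarS hstarT hdense,
    fun _ _ h _ hunit => ⟨h.orderUnitFun honeT hstarS hstarT hdense hunit, archFun hstarS _⟩⟩
  · obtain ⟨f, hf⟩ := exists_extFun (hTS := hTS) hdense g
    exact ⟨f, hf, fun _ h => h.eq_of_dense hdense hf⟩
  · exact ⟨_, extFun_restrict f, fun g h => ContinuousLinearMap.ext fun x => (h x x.2).symm⟩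
end
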